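/- arXiv:2209.05392 — 2 statements merged into one kernel-verified Lean document; each statement's English description precedes it below -/
import Mathlib

section
/- Let (W, S) be a Coxeter system with Coxeter matrix m(s, s'). For a word ω = (s_1, ..., s_r) in the alphabet S, define its left inversion multiset Inv(ω) := {s_1 ⋯ s_{k-1} s_k s_{k-1} ⋯ s_1 : 1 ≤ k ≤ r} (a multiset of elements of W). Suppose the word ω' is obtained from ω by a single braid move: replacing a contiguous factor equal to the alternating word s s' s s' ⋯ of length m(s, s') by the alternating word s' s s' s ⋯ of length m(s, s'), for some s, s' ∈ S with m(s, s') finite. Then Inv(ω) = Inv(ω') as multisets. -/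
open CoxeterSystem

theorem conj_pow_aux {W : Type*} [Group W] (a b : W) (ha : a * a = 1) (k : ℕ) :
    a * ((b * a) ^ k * b) * a⁻¹ = (a * b) ^ (k + 1) * a := by
  have hi : a⁻¹ = a := inv_eq_of_mul_eq_one_left ha
  rw [hi]
  induction k with
  | zero => simp
  | succ k ih =>
    rw [pow_succ' (a * b) (k + 1), mul_assoc (a * b), ← ih, pow_succ']
    simp only [mul_assoc]

theorem lis_alt_aux {B W : Type*} [Group W] {M : CoxeterMatrix B}
    (cs : CoxeterSystem M W) (i j : B) (m : ℕ) :
    (Even m → cs.leftInvSeq (alternatingWord i j m) =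
      (List.range m).map (fun k => (cs.simple i * cs.simple j) ^ k * cs.simple i)) ∧
    (¬ Even m → cs.leftInvSeq (alternatingWord i j m) =
      (List.range m).map (fun k => (cs.simple j * cs.simple i) ^ k * cs.simple j)) := by
  induction m with
  | zero => simp [alternatingWord]
  | succ m ih =>
    rw [alternatingWord_succ']
    by_cases hm : Even m
    · refine ⟨fun h => absurd h (by simp [Nat.even_add_one, hm]), fun _ => ?_⟩
      rw [if_pos hm, leftInvSeq, ih.1 hm, List.range_succ_eq_map]
      simp only [List.map_cons, List.map_map, pow_zero, one_mul, List.cons.injEq, true_and]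
      refine List.map_congr_left fun k _ => ?_
      simpa using conj_pow_aux (cs.simple j) (cs.simple i) (by simp) k
    · refine ⟨fun _ => ?_, fun h => absurd h (by simp [Nat.even_add_one, hm])⟩
      rw [if_neg hm, leftInvSeq, ih.2 hm, List.range_succ_eq_map]
      simp only [List.map_cons, List.map_map, pow_zero, one_mul, List.cons.injEq, true_and]
      refine List.map_congr_left fun k _ => ?_
      simpa using conj_pow_aux (cs.simple i) (cs.simple j) (by simp) k

theorem rev_aux {W : Type*} [Group W] (a b : W) (ha : a * a = 1) (hb : b * b = 1) (m : ℕ)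
    (h : (a * b) ^ m = 1) :
    (List.range m).map (fun k => (b * a) ^ k * b) =
      ((List.range m).map (fun k => (a * b) ^ k * a)).reverse := by
  apply List.ext_getElem
  · simp
  intro k h1 h2
  simp only [List.length_map, List.length_range] at h1
  simp only [List.getElem_reverse, List.getElem_map, List.getElem_range, List.length_map,
    List.length_range]
  have hba : b * a = (a * b)⁻¹ := by
    rw [mul_inv_rev, inv_eq_of_mul_eq_one_left ha, inv_eq_of_mul_eq_one_left hb]
  have e : (a * b) ^ (m - 1 - k) = (b * a) ^ (k + 1) := by
    rw [hba, inv_pow, eq_inv_iff_mul_eq_one, ← pow_add, ← h]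
    congr 1
    omega
  rw [e, pow_succ, mul_assoc, mul_assoc b, ha, mul_one]

theorem lis_append_aux {B W : Type*} [Group W] {M : CoxeterMatrix B}
    (cs : CoxeterSystem M W) (u v : List B) :
    cs.leftInvSeq (u ++ v) =
      cs.leftInvSeq u ++ (cs.leftInvSeq v).map (MulAut.conj (cs.wordProd u)) := by
  induction u with
  | nil => simp
  | cons x u ih =>
    rw [List.cons_append, leftInvSeq, ih, leftInvSeq, wordProd_cons]
    simp [Function.comp_def, mul_assoc]

theorem lis_braid_perm {B W : Type*} [Group W] {M : CoxeterMatrix B}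
    (cs : CoxeterSystem M W) (i j : B) :
    (cs.leftInvSeq (alternatingWord i j (M i j))).Perm
      (cs.leftInvSeq (alternatingWord j i (M i j))) := by
  have hr := rev_aux (cs.simple i) (cs.simple j) (by simp) (by simp) (M i j)
    (cs.simple_mul_simple_pow i j)
  by_cases hm : Even (M i j)
  · rw [(lis_alt_aux cs i j _).1 hm, (lis_alt_aux cs j i _).1 hm, hr]
    exact (List.reverse_perm _).symm
  · rw [(lis_alt_aux cs i j _).2 hm, (lis_alt_aux cs j i _).2 hm, hr]
    exact List.reverse_perm _

/-- in a Coxeter system, if a word `ω'` is obtained from a word `ω`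
by a single braid move (replacing a contiguous alternating factor
`s s' s ⋯` of length `m(s,s')` by `s' s s' ⋯` of length `m(s,s')`, where
`m(s,s')` is finite, i.e. nonzero in Mathlib's convention), then the left
inversion multisets of `ω` and `ω'` coincide. -/
theorem braid_move_leftInvSeq {B W : Type*} [Group W] {M : CoxeterMatrix B}
    (cs : CoxeterSystem M W) (ω ω' : List B)
    (h : ∃ (l₁ l₂ : List B) (i j : B), M i j ≠ 0 ∧
      ω = l₁ ++ alternatingWord i j (M i j) ++ l₂ ∧
      ω' = l₁ ++ alternatingWord j i (M i j) ++ l₂) :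
    (cs.leftInvSeq ω : Multiset W) = (cs.leftInvSeq ω' : Multiset W) := by
  obtain ⟨l₁, l₂, i, j, -, rfl, rfl⟩ := h
  have hw : cs.wordProd (alternatingWord i j (M i j)) =
      cs.wordProd (alternatingWord j i (M i j)) := by
    have := cs.wordProd_braidWord_eq i j
    simpa only [braidWord, M.symmetric j i] using this
  rw [Multiset.coe_eq_coe]
  simp only [lis_append_aux, wordProd_append, hw]
  exact (((lis_braid_perm cs i j).map _).append_left _).append_right _
end

section
/- Let (W, S) be a finite Coxeter system with longest element w₀, let B⁺(W) be the positive braid monoid, and let lift : W → B⁺(W) be the standard lift via reduced words. For w ∈ W let des(w) = {s ∈ S : ℓ(ws) < ℓ(w)} and define Snap(w) := lift(w · w₀(des(w))) · lift(w₀(des(w)))², where w₀(des(w)) is the longest element of the parabolic subgroup generated by des(w). Then Snap(w) is a prefix of the full twist: there exists 𝐳 ∈ B⁺(W) such that Snap(w) · 𝐳 = lift(w₀)². -/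
open CoxeterSystem

/-- The defining relation of the positive braid monoid of a Coxeter matrix `M`. -/
def braidRel {B : Type*} (M : CoxeterMatrix B) : FreeMonoid B → FreeMonoid B → Prop :=
  fun a b => ∃ i j : B, M i j ≠ 0 ∧
    a = FreeMonoid.ofList (alternatingWord i j (M i j)) ∧
    b = FreeMonoid.ofList (alternatingWord j i (M i j))

/-- The positive braid monoid `B⁺(W)` of a Coxeter matrix `M`. -/
abbrev BraidMonoid {B : Type*} (M : CoxeterMatrix B) :=
  (conGen (braidRel M)).Quotient

namespace SnapAux

open List

variable {B W : Type*} [Group W] {M : CoxeterMatrix B} (cs : CoxeterSystem M W)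

open Classical in
/-- The indicator of a proposition, mod 2. -/
noncomputable def ind (P : Prop) : ZMod 2 := if P then 1 else 0

/-- The action of a simple reflection on `W × ZMod 2`. -/
noncomputable def act (i : B) : Function.End (W × ZMod 2) :=
  fun p => (cs.simple i * p.1 * cs.simple i, p.2 + ind (p.1 = cs.simple i))

theorem sr_comm (i j : B) (a : ℕ) :
    (cs.simple i * cs.simple j) ^ a * (cs.simple j * (cs.simple i * cs.simple j) ^ a)
      = cs.simple j := by
  induction a with
  | zero => simp
  | succ a ih =>
    calc _ = (cs.simple i * cs.simple j) ^ a * (cs.simple i * ((cs.simple j * cs.simple j) *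
          cs.simple i) * cs.simple j * (cs.simple i * cs.simple j) ^ a) := by
            nth_rewrite 1 [pow_succ]
            rw [pow_succ']
            simp only [mul_assoc]
      _ = _ := by simpa using ih

theorem act_pow (i j : B) (k : ℕ) (p : W × ZMod 2) :
    ((act cs i * act cs j) ^ k) p =
      ((cs.simple i * cs.simple j) ^ k * p.1 * ((cs.simple i * cs.simple j) ^ k)⁻¹,
        p.2 + ∑ b ∈ Finset.range (2 * k), 
          ind (p.1 = cs.simple j * (cs.simple i * cs.simple j) ^ b)) := by
  induction k with
  | zero => simp; rfl
  | succ k ih =>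
    rw [pow_succ']
    change act cs i (act cs j (((act cs i * act cs j) ^ k) p)) = _
    rw [ih]
    have hc := sr_comm cs i j k
    set r := cs.simple i * cs.simple j with hr
    have e1 : (r ^ k * p.1 * (r ^ k)⁻¹ = cs.simple j) ↔ p.1 = cs.simple j * r ^ (2 * k) := by
      rw [mul_inv_eq_iff_eq_mul, ← eq_inv_mul_iff_mul_eq, two_mul, pow_add, ← mul_assoc (r ^ k)⁻¹]
      rw [← eq_inv_mul_iff_mul_eq] at hc
      rw [← mul_assoc (cs.simple j), hc]
    have e2 : (cs.simple j * (r ^ k * p.1 * (r ^ k)⁻¹) * cs.simple j = cs.simple i) ↔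
        p.1 = cs.simple j * r ^ (2 * k + 1) := by
      have h1 : (cs.simple j * (r ^ k * p.1 * (r ^ k)⁻¹) * cs.simple j = cs.simple i) ↔
          (r ^ k * p.1 * (r ^ k)⁻¹) = cs.simple j * r := by
        constructor
        · intro h
          have : cs.simple j * r = cs.simple j * cs.simple i * cs.simple j := by
            rw [hr, mul_assoc]
          rw [this, ← h]
          simp [mul_assoc]
        · intro h
          rw [h, hr]
          simp [mul_assoc]
      rw [h1, mul_inv_eq_iff_eq_mul, ← eq_inv_mul_iff_mul_eq]
      rw [← eq_inv_mul_iff_mul_eq] at hc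
      have : cs.simple j * r ^ (2 * k + 1) = (r ^ k)⁻¹ * (cs.simple j * r * r ^ k) := by
        have : (2 * k + 1) = k + (1 + k) := by ring
        rw [this, pow_add, pow_add, ← mul_assoc, hc]
        simp [mul_assoc]
      rw [this]
    simp only [act, e1, e2]
    refine Prod.ext ?_ ?_
    · simp only [pow_succ', mul_inv_rev]
      simp [hr, mul_assoc]
    · rw [show 2 * (k + 1) = 2 * k + 1 + 1 by ring, Finset.sum_range_succ, Finset.sum_range_succ]
      simp only [← add_assoc]

theorem act_liftable : M.IsLiftable (act cs) := by
  intro i j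
  funext p
  rw [act_pow]
  have h := cs.simple_mul_simple_pow i j
  rw [h, two_mul, Finset.sum_range_add]
  simp only [pow_add, h, one_mul]
  rw [CharTwo.add_self_eq_zero]
  simp; rfl

theorem act_word (ω : List B) (p : W × ZMod 2) : 
    cs.lift ⟨act cs, act_liftable cs⟩ (cs.wordProd ω) p =
      (cs.wordProd ω * p.1 * (cs.wordProd ω)⁻¹,
        p.2 + ((by classical exact (cs.rightInvSeq ω).count p.1 : ℕ) : ZMod 2)) := by
  induction ω with
  | nil => simp; rfl
  | cons i ω ih =>
    classical
    rw [cs.wordProd_cons, map_mul]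
    change cs.lift ⟨act cs, act_liftable cs⟩ (cs.simple i)
      (cs.lift ⟨act cs, act_liftable cs⟩ (cs.wordProd ω) p) = _
    rw [ih, cs.lift_apply_simple]
    have e : (cs.wordProd ω * p.1 * (cs.wordProd ω)⁻¹ = cs.simple i) ↔
        ((cs.wordProd ω)⁻¹ * cs.simple i * cs.wordProd ω = p.1) := by
      rw [mul_inv_eq_iff_eq_mul, ← eq_inv_mul_iff_mul_eq, eq_comm, mul_assoc]
    simp only [act, e, CoxeterSystem.rightInvSeq, List.count_cons, beq_iff_eq, ind]
    refine Prod.ext ?_ ?_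
    · simp [mul_assoc]
    · push_cast
      rw [add_assoc]

theorem mem_ris (ω : List B) (i : B)
    (h : cs.length (cs.wordProd ω * cs.simple i) < cs.length (cs.wordProd ω)) :
    cs.simple i ∈ cs.rightInvSeq ω := by
  classical
  obtain ⟨α, hα, e⟩ := cs.exists_isReduced (cs.wordProd ω * cs.simple i)
  have e' : cs.wordProd (α.concat i) = cs.wordProd ω := by
    rw [cs.wordProd_concat, ← e]; simp
  have hn : cs.simple i ∉ cs.rightInvSeq α := by
    intro hm
    have := (cs.isRightInversion_of_mem_rightInvSeq hα hm).2
    rw [← e] at this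
    simp at this
    omega
  have h1 := act_word cs ω (cs.simple i, 0)
  have h2 := act_word cs (α.concat i) (cs.simple i, 0)
  rw [e', h1] at h2
  have h3 := congrArg Prod.snd h2
  rw [cs.rightInvSeq_concat] at h3
  have h4 : List.count (cs.simple i) (List.map (MulAut.conj (cs.simple i)) (cs.rightInvSeq α)) = 0 := by
    rw [List.count_eq_zero]
    intro hm
    rw [List.mem_map] at hm
    obtain ⟨t, ht, he⟩ := hm
    apply hn
    rw [MulAut.conj_apply, mul_inv_eq_iff_eq_mul] at he
    rw [← mul_left_cancel he]; exact ht
  by_contra hc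
  have h5 : List.count (cs.simple i) (cs.rightInvSeq ω) = 0 := List.count_eq_zero.2 hc
  simp [h4, h5, List.count_append] at h3

/-- Exchange property. -/
theorem exchange (ω : List B) (i : B)
    (h : cs.length (cs.wordProd ω * cs.simple i) < cs.length (cs.wordProd ω)) :
    ∃ j < ω.length, cs.wordProd ω * cs.simple i = cs.wordProd (ω.eraseIdx j) := by
  obtain ⟨j, hj, e⟩ := List.getElem_of_mem (mem_ris cs ω i h)
  refine ⟨j, by simpa using hj, ?_⟩
  rw [← cs.wordProd_mul_getD_rightInvSeq, List.getD_eq_getElem _ _ hj, e]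

theorem suffix_len (J : Set B) (w : W)
    (hJ : ∀ i ∈ J, cs.length (w * cs.simple i) < cs.length w) (ω : List B)
    (hω : ∀ i ∈ ω, i ∈ J)
    (hmin : ∀ ω' : List B, (∀ i ∈ ω', i ∈ J) → cs.wordProd ω' = cs.wordProd ω →
      ω.length ≤ ω'.length) :
    cs.length (w * (cs.wordProd ω)⁻¹) + ω.length = cs.length w := by
  induction ω using List.reverseRecOn with
  | nil => simp
  | append_singleton ω i ih =>
    have ih := ih (fun k hk => hω k (by simp [hk])) (by
      intro ω' h1 h2
      have := hmin (ω' ++ [i]) (by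
        intro k hk
        rw [List.mem_append] at hk
        rcases hk with hk | hk
        · exact h1 k hk
        · exact hω k (by rw [List.mem_append]; exact Or.inr hk)) (by
        rw [cs.wordProd_append, cs.wordProd_append, h2])
      simpa using this)
    obtain ⟨α, hα, e⟩ := cs.exists_isReduced (w * (cs.wordProd ω)⁻¹)
    have ew : cs.wordProd (α ++ ω) = w := by
      rw [cs.wordProd_append, ← e]; simp
    have hd := hJ i (hω i (by simp))
    rw [← ew] at hd
    obtain ⟨j, hj, ej⟩ := exchange cs _ _ hd
    have hl : cs.length (w * (cs.wordProd ω)⁻¹) = α.length := by rw [e]; exact hα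
    rw [ew] at ej
    have hg : w * (cs.wordProd (ω ++ [i]))⁻¹ = (w * cs.simple i) * (cs.wordProd ω)⁻¹ := by
      rw [cs.wordProd_append]; simp [mul_assoc]
    rw [hg]
    by_cases hjα : j < α.length
    · rw [List.eraseIdx_append_of_lt_length hjα, cs.wordProd_append] at ej
      have h1 : (w * cs.simple i) * (cs.wordProd ω)⁻¹ = cs.wordProd (α.eraseIdx j) := by
        rw [ej]; simp
      have h2 := cs.length_wordProd_le (α.eraseIdx j)
      rw [List.length_eraseIdx_of_lt hjα] at h2
      rw [← h1] at h2
      have h3 := cs.length_mul_le ((w * cs.simple i) * (cs.wordProd ω)⁻¹) (cs.wordProd (ω ++ [i]))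
      rw [← hg] at h3
      rw [inv_mul_cancel_right, hg] at h3
      have h4 := cs.length_wordProd_le (ω ++ [i])
      simp only [List.length_append, List.length_singleton] at h4 ⊢
      omega
    · exfalso
      push Not at hjα
      rw [List.eraseIdx_append_of_length_le hjα, cs.wordProd_append, ← e, ] at ej
      have h1 : cs.wordProd (ω.eraseIdx (j - α.length)) = cs.wordProd (ω ++ [i]) := by
        rw [mul_assoc] at ej
        have := mul_left_cancel ej
        rw [cs.wordProd_append, cs.wordProd_singleton, this]; simp
      have h2 := hmin _ (fun k hk => hω k (by
        rw [List.mem_append]; exact Or.inl (List.mem_of_mem_eraseIdx hk))) h1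
      have := List.length_eraseIdx_le ω (j - α.length)
      simp only [List.length_append, List.length_singleton] at h2
      omega

theorem exists_word (J : Set B) (u : W) (hu : u ∈ Subgroup.closure (cs.simple '' J)) :
    ∃ ω : List B, (∀ i ∈ ω, i ∈ J) ∧ cs.wordProd ω = u := by
  induction hu using Subgroup.closure_induction with
  | mem x hx =>
    obtain ⟨i, hi, rfl⟩ := hx
    exact ⟨[i], by simpa using hi, by simp⟩
  | one => exact ⟨[], by simp, by simp⟩
  | mul x y _ _ hx hy =>
    obtain ⟨a, ha, rfl⟩ := hx
    obtain ⟨b, hb, rfl⟩ := hy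
    refine ⟨a ++ b, ?_, cs.wordProd_append a b⟩
    intro i hi
    rw [List.mem_append] at hi
    exact hi.elim (ha i) (hb i)
  | inv x _ hx =>
    obtain ⟨a, ha, rfl⟩ := hx
    exact ⟨a.reverse, by simpa using ha, by simp⟩

theorem length_add (J : Set B) (w : W)
    (hJ : ∀ i ∈ J, cs.length (w * cs.simple i) < cs.length w) (u : W)
    (hu : u ∈ Subgroup.closure (cs.simple '' J)) :
    cs.length (w * u) + cs.length u = cs.length w := by
  classical
  have hex : ∃ n, ∃ ω : List B, ((∀ i ∈ ω, i ∈ J) ∧ cs.wordProd ω = u⁻¹) ∧ ω.length = n := by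
    obtain ⟨ω, h⟩ := exists_word cs J u⁻¹ (inv_mem hu)
    exact ⟨_, ω, h, rfl⟩
  obtain ⟨ω, ⟨h1, h2⟩, h3⟩ := Nat.find_spec hex
  have h4 := suffix_len cs J w hJ ω h1 (by
    intro ω' h5 h6
    rw [h3]
    exact Nat.find_min' hex ⟨ω', ⟨h5, h6.trans h2⟩, rfl⟩)
  have h5 := cs.length_wordProd_le ω
  rw [h2, cs.length_inv] at h5
  rw [h2, inv_inv] at h4
  have h6 := cs.length_le_length_mul_add_right w u
  omega

theorem length_add_longest (w₀ : W) (hw₀ : ∀ u : W, cs.length u ≤ cs.length w₀) (u : W) :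
    cs.length u + cs.length (u⁻¹ * w₀) = cs.length w₀ := by
  have := length_add cs Set.univ w₀⁻¹ (by
    intro i _
    have h1 := hw₀ (w₀⁻¹ * cs.simple i)
    have h2 := cs.length_mul_simple_ne w₀⁻¹ i
    rw [cs.length_inv] at *
    omega) u (by
    rw [Set.image_univ, cs.subgroup_closure_range_simple]; trivial)
  rw [← cs.length_inv (w₀⁻¹ * u), cs.length_inv w₀] at this
  simp only [mul_inv_rev, inv_inv] at this
  omega

theorem lift_mul (lift : W → BraidMonoid M)
    (hlift : ∀ l : List B, cs.IsReduced l →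
      lift (cs.wordProd l) = Con.mk' (conGen (braidRel M)) (FreeMonoid.ofList l))
    (x y : W) (h : cs.length x + cs.length y = cs.length (x * y)) :
    lift x * lift y = lift (x * y) := by
  obtain ⟨a, ha, rfl⟩ := cs.exists_isReduced x
  obtain ⟨b, hb, rfl⟩ := cs.exists_isReduced y
  have hab : cs.IsReduced (a ++ b) := by
    unfold CoxeterSystem.IsReduced at *
    rw [cs.wordProd_append, ← h, ha, hb, List.length_append]
  rw [← cs.wordProd_append, hlift _ ha, hlift _ hb, hlift _ hab, FreeMonoid.ofList_append, map_mul]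

end SnapAux

theorem snap_prefix_of_full_twist {B W : Type*} [Group W] [Finite W]
    {M : CoxeterMatrix B} (cs : CoxeterSystem M W)
    (lift : W → BraidMonoid M)
    (hlift : ∀ l : List B, cs.IsReduced l →
      lift (cs.wordProd l) = Con.mk' (conGen (braidRel M)) (FreeMonoid.ofList l))
    (w₀ : W) (hw₀ : ∀ u : W, cs.length u ≤ cs.length w₀)
    (w : W) (w₀J : W)
    (hmem : w₀J ∈ Subgroup.closure
      (cs.simple '' {i : B | cs.length (w * cs.simple i) < cs.length w}))
    (hmax : ∀ u ∈ Subgroup.closure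
      (cs.simple '' {i : B | cs.length (w * cs.simple i) < cs.length w}),
      cs.length u ≤ cs.length w₀J) :
    ∃ z : BraidMonoid M,
      lift (w * w₀J) * (lift w₀J * lift w₀J) * z = lift w₀ * lift w₀ := by
  have hΔ : ∀ u : W, lift u * lift (u⁻¹ * w₀) = lift w₀ := by
    intro u
    have := SnapAux.lift_mul cs lift hlift u (u⁻¹ * w₀) (by
      rw [mul_inv_cancel_left]; exact SnapAux.length_add_longest cs w₀ hw₀ u)
    rwa [mul_inv_cancel_left] at this
  -- the longest element of the parabolic is an involution
  have hlen : ∀ u ∈ Subgroup.closure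
      (cs.simple '' {i : B | cs.length (w * cs.simple i) < cs.length w}),
      cs.length (w * u) + cs.length u = cs.length w :=
    fun u hu => SnapAux.length_add cs _ w (fun i hi => hi) u hu
  have hJ : w₀J * w₀J = 1 := by
    have hd : ∀ i ∈ {i : B | cs.length (w * cs.simple i) < cs.length w},
        cs.length (w₀J * cs.simple i) < cs.length w₀J := by
      intro i hi
      have h1 := hmax (w₀J * cs.simple i)
        (mul_mem hmem (Subgroup.subset_closure ⟨i, hi, rfl⟩))
      have h2 := cs.length_mul_simple_ne w₀J i
      omega
    have := SnapAux.length_add cs _ w₀J hd w₀J hmem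
    exact cs.length_eq_zero_iff.1 (by omega)
  have hw : lift (w * w₀J) * lift w₀J = lift w := by
    have := SnapAux.lift_mul cs lift hlift (w * w₀J) w₀J (by
      rw [mul_assoc, hJ, mul_one]; exact hlen _ hmem)
    rwa [mul_assoc, hJ, mul_one] at this
  -- the half twist is quasi-central
  have hq : ∀ u : W, lift u * lift w₀ = lift w₀ * lift (w₀⁻¹ * u * w₀) := by
    intro u
    have h1 := hΔ (u⁻¹ * w₀)
    rw [mul_inv_rev, inv_inv] at h1
    rw [← h1, ← mul_assoc, hΔ u, h1]
  refine ⟨lift (w₀J⁻¹ * w₀) * lift (w₀⁻¹ * (w⁻¹ * w₀) * w₀), ?_⟩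
  calc lift (w * w₀J) * (lift w₀J * lift w₀J) *
        (lift (w₀J⁻¹ * w₀) * lift (w₀⁻¹ * (w⁻¹ * w₀) * w₀))
      = (lift (w * w₀J) * lift w₀J) * ((lift w₀J * lift (w₀J⁻¹ * w₀)) *
          lift (w₀⁻¹ * (w⁻¹ * w₀) * w₀)) := by simp only [mul_assoc]
    _ = lift w * (lift (w⁻¹ * w₀) * lift w₀) := by rw [hw, hΔ, ← hq]
    _ = lift w₀ * lift w₀ := by rw [← mul_assoc, hΔ]
end
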